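/- Let P = (p, r) be a collectively jammed packing of n disks in the torus ℝ²/Λ(a₀, b₀), where Λ(a, b) is the lattice with basis (a, 0), (b, 1/a), a > 0. Then for every sufficiently small ε > 0, the set of parameters (r̄, a, b) ∈ ℝ^{n−1} × ℝ × ℝ for which there exists a locally maximally dense packing of n disks in ℝ²/Λ(a, b) with radius ratios r̄ and centers within ε of p contains an open neighborhood of (r̄₀, a₀, b₀), where r̄₀ = (r₂/r₁, …, rₙ/r₁); in particular this set has Hausdorff dimension n + 1. -/

import Mathlib

noncomputable section

open scoped RealInnerProductSpace

namespace IsostaticPaper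

/-- Points of the Euclidean plane `ℝ²`. -/
abbrev Pt : Type := EuclideanSpace ℝ (Fin 2)

/-- The point `(x, y) ∈ ℝ²`. -/
def vec (x y : ℝ) : Pt := (WithLp.equiv 2 (Fin 2 → ℝ)).symm ![x, y]

/-- The lattice `Λ ⊆ ℝ²` spanned over `ℤ` by the two vectors `v₁, v₂`. -/
def lat (v₁ v₂ : Pt) : Set Pt :=
  {l : Pt | ∃ z₁ z₂ : ℤ, l = (z₁ : ℝ) • v₁ + (z₂ : ℝ) • v₂}

/-- `(p, r)` is a packing of disks in the flat torus `ℝ²/Λ`: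
all radii are positive and `‖pᵢ - pⱼ + λ‖ ≥ rᵢ + rⱼ` for all `i, j` and all
`λ ∈ Λ` with `(j, λ) ≠ (i, 0)`. -/
def IsPacking (Λ : Set Pt) {ι : Type} (p : ι → Pt) (r : ι → ℝ) : Prop :=
  (∀ i, 0 < r i) ∧
  ∀ i j : ι, ∀ l ∈ Λ, ¬(j = i ∧ l = 0) → r i + r j ≤ ‖p i - p j + l‖

/-- A contact of the packing `(p, r)` is a triple `(i, j, λ)`, `λ ∈ Λ`,
`(j, λ) ≠ (i, 0)`, with `‖pᵢ - pⱼ + λ‖ = rᵢ + rⱼ`. -/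
def IsContact (Λ : Set Pt) {ι : Type} (p : ι → Pt) (r : ι → ℝ) (c : ι × ι × Pt) : Prop :=
  c.2.2 ∈ Λ ∧ ¬(c.2.1 = c.1 ∧ c.2.2 = 0) ∧ ‖p c.1 - p c.2.1 + c.2.2‖ = r c.1 + r c.2.1

/-- A packing `(p, r)` in `ℝ²/Λ` is collectively jammed if every continuous path of
configurations `t ↦ q t`, `t ∈ [0,1]`, starting at `p` and keeping `(q t, r)` a packing,
moves `p` only by translations. -/
def CollectivelyJammed (Λ : Set Pt) {ι : Type} (p : ι → Pt) (r : ι → ℝ) : Prop :=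
  ∀ q : ℝ → ι → Pt,
    (∀ i, ContinuousOn (fun t => q t i) (Set.Icc 0 1)) →
    q 0 = p →
    (∀ t ∈ Set.Icc (0:ℝ) 1, IsPacking Λ (q t) r) →
    ∀ t ∈ Set.Icc (0:ℝ) 1, ∀ i j, q t i - p i = q t j - p j

/-- Euclidean distance between two configurations of centers. -/
def pdist {ι : Type} [Fintype ι] (p q : ι → Pt) : ℝ :=
  Real.sqrt (∑ i, ‖p i - q i‖ ^ 2)

/-- Euclidean distance between two vectors of radii. -/
def rdist {ι : Type} [Fintype ι] (r s : ι → ℝ) : ℝ :=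
  Real.sqrt (∑ i, (r i - s i) ^ 2)

/-- Determinant of the pair of lattice basis vectors `v₁, v₂`. -/
def det2 (v₁ v₂ : Pt) : ℝ := v₁ 0 * v₂ 1 - v₁ 1 * v₂ 0

/-- Density of a packing with radii `r` in the torus with lattice basis `v₁, v₂`. -/
def density (v₁ v₂ : Pt) {ι : Type} [Fintype ι] (r : ι → ℝ) : ℝ :=
  Real.pi * (∑ i, r i ^ 2) / |det2 v₁ v₂|

/-- `(p, r)` is locally maximally dense in the torus with lattice basis `v₁, v₂`:
it is a packing and, for some `ε > 0`, every nearby packing whose radii are a positive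
scalar multiple of `r` has density at most that of `(p, r)`. -/
def LocallyMaxDense (v₁ v₂ : Pt) {ι : Type} [Fintype ι] (p : ι → Pt) (r : ι → ℝ) : Prop :=
  IsPacking (lat v₁ v₂) p r ∧
  ∃ ε > 0, ∀ (q : ι → Pt) (t : ℝ), 0 < t →
    IsPacking (lat v₁ v₂) q (fun i => t * r i) →
    pdist q p < ε → rdist (fun i => t * r i) r < ε →
    density v₁ v₂ (fun i => t * r i) ≤ density v₁ v₂ r

/-- An infinitesimal flex `p'` of the packing: `(pᵢ - pⱼ + λ) · (p'ᵢ - p'ⱼ) ≥ 0`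
for every contact `(i, j, λ)`. -/
def IsInfFlex (Λ : Set Pt) {ι : Type} (p : ι → Pt) (r : ι → ℝ) (p' : ι → Pt) : Prop :=
  ∀ c : ι × ι × Pt, IsContact Λ p r c →
    0 ≤ ⟪p c.1 - p c.2.1 + c.2.2, p' c.1 - p' c.2.1⟫

/-- The packing is infinitesimally rigid if every infinitesimal flex is trivial
(all `p'ᵢ` equal). -/
def InfinitesimallyRigid (Λ : Set Pt) {ι : Type} (p : ι → Pt) (r : ι → ℝ) : Prop :=
  ∀ p' : ι → Pt, IsInfFlex Λ p r p' → ∀ i j, p' i = p' j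

/-- The space of equilibrium stresses of a packing whose (finite) set of ordered
contact triples is `K`: scalars on contacts with `ω(i,j,λ) = ω(j,i,-λ)`, vanishing off
`K`, in equilibrium at every vertex. -/
def stressSpace {n : ℕ} (K : Finset (Fin n × Fin n × Pt)) (p : Fin n → Pt) :
    Submodule ℝ ((Fin n × Fin n × Pt) → ℝ) where
  carrier := {ω | (∀ c ∉ K, ω c = 0) ∧
    (∀ i j l, ω (i, j, l) = ω (j, i, -l)) ∧
    (∀ i, ∑ c ∈ K.filter (fun c => c.1 = i), ω c • (p c.1 - p c.2.1 + c.2.2) = 0)}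
  zero_mem' := ⟨fun _ _ => rfl, fun _ _ _ => rfl, fun i => by simp⟩
  add_mem' := by
    rintro ω₁ ω₂ ⟨h1, h2, h3⟩ ⟨g1, g2, g3⟩
    refine ⟨fun c hc => ?_, fun i j l => ?_, fun i => ?_⟩
    · simp [h1 c hc, g1 c hc]
    · simp [h2 i j l, g2 i j l]
    · simp only [Pi.add_apply, add_smul, Finset.sum_add_distrib, h3 i, g3 i, add_zero]
  smul_mem' := by
    rintro t ω ⟨h1, h2, h3⟩
    refine ⟨fun c hc => ?_, fun i j l => ?_, fun i => ?_⟩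
    · simp [h1 c hc]
    · simp [h2 i j l]
    · simp only [Pi.smul_apply, smul_assoc, ← Finset.smul_sum, h3 i, smul_zero]


/-- For `a > 0` and `b`, the unit-determinant lattice `Λ(a, b)` with basis
`(a, 0), (b, 1/a)`. -/
def latAB (a b : ℝ) : Set Pt := lat (vec a 0) (vec b (1 / a))

/-- The set of parameters `(r̄, a, b)` for which there is a locally maximally dense
packing of `n` disks in `ℝ²/Λ(a, b)` with radius ratios `r̄` and centers within `ε`
of `p`. -/
def paramSet (n : ℕ) (hn : 0 < n) (p : Fin n → Pt) (ε : ℝ) :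
    Set ((Fin (n - 1) → ℝ) × ℝ × ℝ) :=
  {x | 0 < x.2.1 ∧ ∃ (q : Fin n → Pt) (s : Fin n → ℝ),
    LocallyMaxDense (vec x.2.1 0) (vec x.2.2 (1 / x.2.1)) q s ∧
    (∀ i : Fin (n - 1), s ⟨(i : ℕ) + 1, by have := i.isLt; omega⟩ / s ⟨0, hn⟩ = x.1 i) ∧
    pdist q p < ε}

/-- The vector `z₁ (a, 0) + z₂ (b, c)`. -/
def latVec (a b c : ℝ) (z : ℤ × ℤ) : Pt := (z.1 : ℝ) • vec a 0 + (z.2 : ℝ) • vec b c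

/-- The separation inequalities of a packing in the lattice spanned by `(a, 0), (b, c)`,
indexed by integer coordinates of the lattice vectors. -/
def Separated {ι : Type} (q : ι → Pt) (s : ι → ℝ) (a b c : ℝ) : Prop :=
  ∀ i j (z : ℤ × ℤ), ¬(j = i ∧ z = 0) → s i + s j ≤ ‖q i - q j + latVec a b c z‖

lemma vec_apply_zero (x y : ℝ) : vec x y 0 = x := by simp [vec]

lemma vec_apply_one (x y : ℝ) : vec x y 1 = y := by simp [vec]

lemma latVec_apply_zero (a b c : ℝ) (z : ℤ × ℤ) : latVec a b c z 0 = z.1 * a + z.2 * b := by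
  simp [latVec, vec_apply_zero]

lemma latVec_apply_one (a b c : ℝ) (z : ℤ × ℤ) : latVec a b c z 1 = z.2 * c := by
  simp [latVec, vec_apply_one]

lemma continuous_vec : Continuous fun x : ℝ × ℝ => vec x.1 x.2 := by
  refine (PiLp.continuous_toLp 2 (fun _ : Fin 2 => ℝ)).comp (continuous_pi fun i => ?_)
  fin_cases i
  · exact continuous_fst
  · exact continuous_snd

lemma continuous_latVec (z : ℤ × ℤ) :
    Continuous fun x : ℝ × ℝ × ℝ => latVec x.1 x.2.1 x.2.2 z := by
  have h₁ : Continuous fun x : ℝ × ℝ × ℝ => vec x.1 0 :=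
    continuous_vec.comp (continuous_fst.prodMk continuous_const)
  have h₂ : Continuous fun x : ℝ × ℝ × ℝ => vec x.2.1 x.2.2 :=
    continuous_vec.comp continuous_snd
  exact (h₁.const_smul (z.1 : ℝ)).add (h₂.const_smul (z.2 : ℝ))

lemma latVec_zero (a b c : ℝ) : latVec a b c 0 = 0 := by simp [latVec]

lemma latVec_eq_zero_iff {a b c : ℝ} (ha : a ≠ 0) (hc : c ≠ 0) (z : ℤ × ℤ) :
    latVec a b c z = 0 ↔ z = 0 := by
  refine ⟨fun h => ?_, fun h => by rw [h, latVec_zero]⟩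
  have h₁ : (z.2 : ℝ) * c = 0 := by rw [← latVec_apply_one a b c, h]; rfl
  have h₂ : (z.2 : ℝ) = 0 := (mul_eq_zero.mp h₁).resolve_right hc
  have h₃ : (z.1 : ℝ) * a + z.2 * b = 0 := by rw [← latVec_apply_zero a b c, h]; rfl
  rw [h₂, zero_mul, add_zero] at h₃
  have h₄ : (z.1 : ℝ) = 0 := (mul_eq_zero.mp h₃).resolve_right ha
  exact Prod.ext (by exact_mod_cast h₄) (by exact_mod_cast h₂)

lemma isPacking_iff_separated {ι : Type} {a b c : ℝ} (ha : a ≠ 0) (hc : c ≠ 0)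
    (q : ι → Pt) (s : ι → ℝ) :
    IsPacking (lat (vec a 0) (vec b c)) q s ↔ (∀ i, 0 < s i) ∧ Separated q s a b c := by
  refine and_congr_right fun _ => ⟨fun h i j z hz => ?_, ?_⟩
  · refine h i j _ ⟨z.1, z.2, rfl⟩ ?_
    exact mt (And.imp_right (latVec_eq_zero_iff ha hc z).mp) hz
  · rintro h i j _ ⟨z₁, z₂, rfl⟩ hl
    refine h i j (z₁, z₂) fun hz => hl ⟨hz.1, ?_⟩
    exact (latVec_eq_zero_iff ha hc (z₁, z₂)).mpr hz.2

lemma Separated.mono {ι : Type} {q : ι → Pt} {s s' : ι → ℝ} {a b c : ℝ}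
    (h : Separated q s a b c) (hs : ∀ i, s' i ≤ s i) : Separated q s' a b c :=
  fun i j z hz => (add_le_add (hs i) (hs j)).trans (h i j z hz)

lemma Separated.sub_const {ι : Type} {q : ι → Pt} {s : ι → ℝ} {a b c : ℝ}
    (h : Separated q s a b c) (v : Pt) : Separated (fun i => q i - v) s a b c := by
  intro i j z hz
  simpa only [sub_sub_sub_cancel_right] using h i j z hz

lemma isClosed_separated (ι : Type) :
    IsClosed {y : (ι → Pt) × (ι → ℝ) × ℝ × ℝ × ℝ |
      Separated y.1 y.2.1 y.2.2.1 y.2.2.2.1 y.2.2.2.2} := by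
  simp only [Separated, Set.ofPred_forall]
  refine isClosed_iInter fun i => isClosed_iInter fun j => isClosed_iInter fun z =>
    isClosed_iInter fun _ => isClosed_le (by fun_prop) ?_
  have h := (continuous_latVec z).comp
    (continuous_snd.comp (continuous_snd (X := ι → Pt) (Y := (ι → ℝ) × ℝ × ℝ × ℝ)))
  refine Continuous.norm (Continuous.add (by fun_prop) h)

/-- Only lattice vectors with bounded coordinates can have bounded length, uniformly for
bases away from degeneracy. -/
lemma latVec_coords_le {a b c α β γ M : ℝ} (hα : 0 < α) (hγ : 0 < γ)
    (ha : α ≤ a) (hb : |b| ≤ β) (hc : γ ≤ c) {z : ℤ × ℤ} (hz : ‖latVec a b c z‖ ≤ M) :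
    |(z.1 : ℝ)| ≤ (M + M / γ * β) / α ∧ |(z.2 : ℝ)| ≤ M / γ := by
  have h₀ : |(z.1 : ℝ) * a + z.2 * b| ≤ M := by
    rw [← latVec_apply_zero a b c]
    exact (PiLp.norm_apply_le (latVec a b c z) 0).trans hz
  have h₁ : |(z.2 : ℝ) * c| ≤ M := by
    rw [← latVec_apply_one a b c]
    exact (PiLp.norm_apply_le (latVec a b c z) 1).trans hz
  have hz₂ : |(z.2 : ℝ)| ≤ M / γ := by
    rw [le_div_iff₀ hγ]
    rw [abs_mul, abs_of_pos (hγ.trans_le hc)] at h₁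
    exact (mul_le_mul_of_nonneg_left hc (abs_nonneg _)).trans h₁
  refine ⟨?_, hz₂⟩
  rw [le_div_iff₀ hα]
  have h₂ : |(z.1 : ℝ) * a| ≤ M + M / γ * β := by
    calc |(z.1 : ℝ) * a| = |((z.1 : ℝ) * a + z.2 * b) - z.2 * b| := by ring_nf
      _ ≤ |(z.1 : ℝ) * a + z.2 * b| + |(z.2 : ℝ) * b| := abs_sub _ _
      _ ≤ M + M / γ * β := by
        rw [abs_mul (z.2 : ℝ)]
        exact add_le_add h₀ (mul_le_mul hz₂ hb (abs_nonneg _) ((abs_nonneg _).trans hz₂))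
  rw [abs_mul, abs_of_pos (hα.trans_le ha)] at h₂
  exact (mul_le_mul_of_nonneg_left ha (abs_nonneg _)).trans h₂

/-- Strict separation inequalities persist, simultaneously for all lattice vectors, under small
perturbations of the centers, the radii and the lattice. -/
lemma eventually_strict_separated {n : ℕ} (p : Fin n → Pt) (ρ : Fin n → ℝ) {a b c : ℝ}
    (ha : 0 < a) (hc : 0 < c) :
    ∀ᶠ y : (Fin n → Pt) × (Fin n → ℝ) × ℝ × ℝ × ℝ in nhds (p, ρ, a, b, c),
      ∀ i j z, ρ i + ρ j < ‖p i - p j + latVec a b c z‖ →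
        y.2.1 i + y.2.1 j <
          ‖y.1 i - y.1 j + latVec y.2.2.1 y.2.2.2.1 y.2.2.2.2 z‖ := by
  set M : ℝ := 2 * (‖p‖ + 1) + 2 * (‖ρ‖ + 1) with hM
  obtain ⟨N, hN⟩ := exists_nat_ge
    (max ((M + M / (c / 2) * (|b| + 1)) / (a / 2)) (M / (c / 2)))
  let T : Finset (ℤ × ℤ) := Finset.Icc (-(N : ℤ)) N ×ˢ Finset.Icc (-(N : ℤ)) N
  have hfin : ∀ᶠ y : (Fin n → Pt) × (Fin n → ℝ) × ℝ × ℝ × ℝ in nhds (p, ρ, a, b, c),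
      ∀ i j, ∀ z ∈ T, ρ i + ρ j < ‖p i - p j + latVec a b c z‖ →
        y.2.1 i + y.2.1 j <
          ‖y.1 i - y.1 j + latVec y.2.2.1 y.2.2.2.1 y.2.2.2.2 z‖ := by
    refine Filter.eventually_all.mpr fun i => Filter.eventually_all.mpr fun j =>
      (Filter.eventually_all_finset T).mpr fun z _ => ?_
    by_cases h : ρ i + ρ j < ‖p i - p j + latVec a b c z‖
    · have hl := (continuous_latVec z).comp
        (continuous_snd.comp
          (continuous_snd (X := Fin n → Pt) (Y := (Fin n → ℝ) × ℝ × ℝ × ℝ)))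
      have hL : Continuous fun y : (Fin n → Pt) × (Fin n → ℝ) × ℝ × ℝ × ℝ =>
          y.2.1 i + y.2.1 j := by fun_prop
      have hR : Continuous fun y : (Fin n → Pt) × (Fin n → ℝ) × ℝ × ℝ × ℝ =>
          ‖y.1 i - y.1 j + latVec y.2.2.1 y.2.2.2.1 y.2.2.2.2 z‖ :=
        Continuous.norm (Continuous.add (by fun_prop) hl)
      exact (hL.continuousAt.eventually_lt hR.continuousAt h).mono fun y hy _ => hy
    · exact Filter.Eventually.of_forall fun y hy => absurd hy h
  have hp : ∀ᶠ y : (Fin n → Pt) × (Fin n → ℝ) × ℝ × ℝ × ℝ in nhds (p, ρ, a, b, c),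
      ‖y.1‖ < ‖p‖ + 1 ∧ ‖y.2.1‖ < ‖ρ‖ + 1 ∧ a / 2 < y.2.2.1 ∧ |y.2.2.2.1| < |b| + 1 ∧
        c / 2 < y.2.2.2.2 := by
    have h₁ : Continuous fun y : (Fin n → Pt) × (Fin n → ℝ) × ℝ × ℝ × ℝ => ‖y.1‖ := by fun_prop
    have h₂ : Continuous fun y : (Fin n → Pt) × (Fin n → ℝ) × ℝ × ℝ × ℝ => ‖y.2.1‖ := by fun_prop
    have h₃ : Continuous fun y : (Fin n → Pt) × (Fin n → ℝ) × ℝ × ℝ × ℝ => y.2.2.1 := by fun_prop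
    have h₄ : Continuous fun y : (Fin n → Pt) × (Fin n → ℝ) × ℝ × ℝ × ℝ => |y.2.2.2.1| := by
      fun_prop
    have h₅ : Continuous fun y : (Fin n → Pt) × (Fin n → ℝ) × ℝ × ℝ × ℝ => y.2.2.2.2 := by
      fun_prop
    filter_upwards [(h₁.tendsto (p, ρ, a, b, c)).eventually_lt_const (lt_add_one ‖p‖),
      (h₂.tendsto (p, ρ, a, b, c)).eventually_lt_const (lt_add_one ‖ρ‖),
      (h₃.tendsto (p, ρ, a, b, c)).eventually_const_lt (half_lt_self ha),
      (h₄.tendsto (p, ρ, a, b, c)).eventually_lt_const (lt_add_one |b|),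
      (h₅.tendsto (p, ρ, a, b, c)).eventually_const_lt (half_lt_self hc)]
      with y hy₁ hy₂ hy₃ hy₄ hy₅
    exact ⟨hy₁, hy₂, hy₃, hy₄, hy₅⟩
  filter_upwards [hfin, hp] with y hy ⟨hy₁, hy₂, hya, hyb, hyc⟩ i j z hz
  by_contra! hlt
  refine hlt.not_gt (hy i j z ?_ hz)
  have hlen : ‖latVec y.2.2.1 y.2.2.2.1 y.2.2.2.2 z‖ ≤ M := by
    have e₁ : ‖latVec y.2.2.1 y.2.2.2.1 y.2.2.2.2 z‖ ≤
        ‖y.1 i - y.1 j + latVec y.2.2.1 y.2.2.2.1 y.2.2.2.2 z‖ + ‖y.1 i - y.1 j‖ := by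
      simpa using norm_sub_le (y.1 i - y.1 j + latVec y.2.2.1 y.2.2.2.1 y.2.2.2.2 z)
        (y.1 i - y.1 j)
    have e₂ := norm_sub_le (y.1 i) (y.1 j)
    have e₃ := norm_le_pi_norm y.1 i
    have e₄ := norm_le_pi_norm y.1 j
    have e₅ := (le_abs_self _).trans (norm_le_pi_norm y.2.1 i)
    have e₆ := (le_abs_self _).trans (norm_le_pi_norm y.2.1 j)
    linarith
  obtain ⟨h₁, h₂⟩ := latVec_coords_le (half_pos ha) (half_pos hc) hya.le hyb.le hyc.le hlen
  have h₁' := abs_le.mp (h₁.trans ((le_max_left _ _).trans hN))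
  have h₂' := abs_le.mp (h₂.trans ((le_max_right _ _).trans hN))
  simp only [T, Finset.mem_product, Finset.mem_Icc]
  exact_mod_cast And.intro h₁' h₂'

/-- A direction which does not shorten any contact to first order is realized by a straight
motion through packings. -/
lemma eventually_separated_of_flex {n : ℕ} {p : Fin n → Pt} {r : Fin n → ℝ} {a b c : ℝ}
    (ha : 0 < a) (hc : 0 < c) (hp : Separated p r a b c) {u : Fin n → Pt}
    (hu : ∀ i j z, ‖p i - p j + latVec a b c z‖ = r i + r j →
      0 ≤ ⟪p i - p j + latVec a b c z, u i - u j⟫) :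
    ∀ᶠ t : ℝ in nhds 0, 0 ≤ t → Separated (p + t • u) r a b c := by
  have htend : Filter.Tendsto (fun t : ℝ => (p + t • u, r, a, b, c)) (nhds 0)
      (nhds (p, r, a, b, c)) := by
    have : Continuous fun t : ℝ => (p + t • u, r, a, b, c) := by fun_prop
    simpa using this.tendsto 0
  filter_upwards [htend.eventually (eventually_strict_separated p r (b := b) ha hc)]
    with t ht ht₀ i j z hz
  rcases (hp i j z hz).lt_or_eq with h | h
  · exact (ht i j z h).le
  · have hflex := hu i j z h.symm
    have hvec : (p + t • u) i - (p + t • u) j + latVec a b c z =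
        (p i - p j + latVec a b c z) + t • (u i - u j) := by
      simp only [Pi.add_apply, Pi.smul_apply, smul_sub]; abel
    rw [hvec, h]
    refine le_of_sq_le_sq ?_ (norm_nonneg _)
    rw [norm_add_sq_real _ (t • (u i - u j)), real_inner_smul_right]
    nlinarith [mul_nonneg ht₀ hflex, sq_nonneg ‖t • (u i - u j)‖]

/-- The centers of a collectively jammed packing are isolated among the packings with the same
radii, once translations are fixed by pinning one center. -/
lemma CollectivelyJammed.exists_isolated {n : ℕ} {p : Fin n → Pt} {r : Fin n → ℝ} {a b c : ℝ}
    (ha : 0 < a) (hc : 0 < c) (hp : IsPacking (lat (vec a 0) (vec b c)) p r)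
    (hjam : CollectivelyJammed (lat (vec a 0) (vec b c)) p r) (o : Fin n) :
    ∃ δ > 0, ∀ q : Fin n → Pt, q o = p o → ‖q - p‖ ≤ δ → Separated q r a b c → q = p := by
  obtain ⟨hr, hsep⟩ := (isPacking_iff_separated ha.ne' hc.ne' p r).mp hp
  by_contra! hcon
  choose q hqo hqp hqs hne using fun k : ℕ =>
    hcon (1 / ((k : ℝ) + 1)) (by positivity)
  have hpos (k : ℕ) : 0 < ‖q k - p‖ := norm_pos_iff.mpr (sub_ne_zero.mpr (hne k))
  let u (k : ℕ) : Fin n → Pt := ‖q k - p‖⁻¹ • (q k - p)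
  have hu_norm (k : ℕ) : u k ∈ Metric.sphere (0 : Fin n → Pt) 1 := by
    rw [mem_sphere_zero_iff_norm, norm_smul, norm_inv, norm_norm, inv_mul_cancel₀ (hpos k).ne']
  have hqu (k : ℕ) (i : Fin n) : q k i = p i + ‖q k - p‖ • u k i := by
    simp only [u, Pi.smul_apply, smul_inv_smul₀ (hpos k).ne', Pi.sub_apply, add_sub_cancel]
  obtain ⟨v, hv, φ, hφ, hlim⟩ := (isCompact_sphere (0 : Fin n → Pt) 1).tendsto_subseq hu_norm
  have hlimi (i : Fin n) : Filter.Tendsto (fun k => u (φ k) i) Filter.atTop (nhds (v i)) :=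
    (tendsto_pi_nhds.mp hlim) i
  have hdist : Filter.Tendsto (fun k => ‖q (φ k) - p‖) Filter.atTop (nhds 0) :=
    (squeeze_zero (fun k => norm_nonneg _) hqp tendsto_one_div_add_atTop_nhds_zero_nat).comp
      hφ.tendsto_atTop
  have hvo : v o = 0 := by
    refine tendsto_nhds_unique (hlimi o) ?_
    have : (fun k => u (φ k) o) = fun _ => 0 := by
      funext k
      simp [u, hqo]
    rw [this]
    exact tendsto_const_nhds
  have hflex : ∀ i j z, ‖p i - p j + latVec a b c z‖ = r i + r j →
      0 ≤ ⟪p i - p j + latVec a b c z, v i - v j⟫ := by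
    intro i j z hcontact
    by_cases hz : j = i ∧ z = 0
    · simp [hz.1]
    set d := p i - p j + latVec a b c z with hd
    have hdiff := (hlimi i).sub (hlimi j)
    have hL : Filter.Tendsto
        (fun k => 2 * ⟪d, u (φ k) i - u (φ k) j⟫ +
          ‖q (φ k) - p‖ * ‖u (φ k) i - u (φ k) j‖ ^ 2) Filter.atTop
        (nhds (2 * ⟪d, v i - v j⟫ + 0 * ‖v i - v j‖ ^ 2)) :=
      ((tendsto_const_nhds.inner hdiff).const_mul 2).add (hdist.mul (hdiff.norm.pow 2))
    have hnonneg : 0 ≤ 2 * ⟪d, v i - v j⟫ + 0 * ‖v i - v j‖ ^ 2 := by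
      refine ge_of_tendsto' hL fun k => ?_
      set w := u (φ k) i - u (φ k) j with hw
      set m := ‖q (φ k) - p‖ with hm
      have hmpos : 0 < m := hpos (φ k)
      have hvec : q (φ k) i - q (φ k) j + latVec a b c z = d + m • w := by
        rw [hqu (φ k) i, hqu (φ k) j, hd, hw, smul_sub]; abel
      have h := hqs (φ k) i j z hz
      rw [hvec, ← hcontact] at h
      have h₂ := pow_le_pow_left₀ (norm_nonneg d) h 2
      rw [norm_add_sq_real d, real_inner_smul_right, norm_smul, Real.norm_of_nonneg hmpos.le] at h₂
      refine nonneg_of_mul_nonneg_right (a := m) ?_ hmpos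
      nlinarith
    linarith
  obtain ⟨τ, hτ, hτsep⟩ := Metric.eventually_nhds_iff.mp
    (eventually_separated_of_flex ha hc hsep hflex)
  have hjam' := hjam (fun t => p + (t * (τ / 2)) • v)
    (fun i => by
      have : Continuous fun t : ℝ => (p + (t * (τ / 2)) • v) i := by
        simp only [Pi.add_apply, Pi.smul_apply]; fun_prop
      exact this.continuousOn)
    (by simp)
    (fun t ht => (isPacking_iff_separated ha.ne' hc.ne' _ r).mpr ⟨hr, hτsep (by
      rw [Real.dist_eq, sub_zero, abs_of_nonneg (mul_nonneg ht.1 (half_pos hτ).le)]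
      nlinarith [ht.2]) (mul_nonneg ht.1 (half_pos hτ).le)⟩)
  have hv0 : v = 0 := by
    funext i
    have h := hjam' 1 ⟨zero_le_one, le_rfl⟩ i o
    simp only [Pi.add_apply, Pi.smul_apply, add_sub_cancel_left, hvo, smul_zero, one_mul] at h
    exact (smul_eq_zero.mp h).resolve_left (half_pos hτ).ne'
  rw [hv0, mem_sphere_zero_iff_norm, norm_zero] at hv
  exact zero_ne_one hv

lemma norm_sub_le_pdist {ι : Type} [Fintype ι] (p q : ι → Pt) : ‖p - q‖ ≤ pdist p q := by
  refine (pi_norm_le_iff_of_nonneg (Real.sqrt_nonneg _)).mpr fun i => ?_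
  refine Real.le_sqrt_of_sq_le ?_
  exact Finset.single_le_sum (f := fun i => ‖p i - q i‖ ^ 2) (fun _ _ => sq_nonneg _)
    (Finset.mem_univ i)

lemma pdist_le_card_mul_norm_sub {ι : Type} [Fintype ι] (p q : ι → Pt) :
    pdist p q ≤ Fintype.card ι * ‖p - q‖ := by
  refine Real.sqrt_le_iff.mpr ⟨by positivity, ?_⟩
  calc ∑ i, ‖p i - q i‖ ^ 2 ≤ ∑ _i : ι, ‖p - q‖ ^ 2 :=
        Finset.sum_le_sum fun i _ =>
          pow_le_pow_left₀ (norm_nonneg _) (norm_le_pi_norm (p - q) i) 2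
    _ = Fintype.card ι * ‖p - q‖ ^ 2 := by simp
    _ ≤ (Fintype.card ι * ‖p - q‖) ^ 2 := by
      rw [mul_pow]
      refine mul_le_mul_of_nonneg_right ?_ (sq_nonneg _)
      exact_mod_cast Nat.le_self_pow two_ne_zero _

/-- If `(p, s)` is a packing and no packing with radii `s` has its centers at sup-distance exactly
`δ` from `p` with `q o = p o`, then some dilate of `s` occurs as the radii of a locally maximally
dense packing with centers within `δ` of `p`. -/
lemma exists_locallyMaxDense {n : ℕ} {p : Fin n → Pt} {s : Fin n → ℝ} {a b c δ : ℝ}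
    (ha : 0 < a) (hc : 0 < c) (hδ : 0 < δ) (o : Fin n) (hs : ∀ i, 0 < s i)
    (hp : Separated p s a b c)
    (hsphere : ∀ q : Fin n → Pt, q o = p o → ‖q - p‖ = δ → ¬Separated q s a b c) :
    ∃ (q : Fin n → Pt) (t : ℝ), 0 < t ∧ ‖q - p‖ < δ ∧
      LocallyMaxDense (vec a 0) (vec b c) q (fun i => t * s i) := by
  let C : ℝ := ‖latVec a b c (1, 0)‖ / (2 * s o)
  let K : Set ((Fin n → Pt) × ℝ) :=
    (Metric.closedBall p δ ×ˢ Set.Icc 1 C) ∩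
      {y | y.1 o = p o ∧ Separated y.1 (fun i => y.2 * s i) a b c}
  have hC {q : Fin n → Pt} {t : ℝ} (h : Separated q (fun i => t * s i) a b c) : t ≤ C := by
    rw [le_div_iff₀ (by linarith [hs o])]
    have := h o o (1, 0) (by simp)
    rw [sub_self, zero_add] at this
    linarith
  have hK : IsCompact K := by
    refine ((isCompact_closedBall p δ).prod isCompact_Icc).inter_right ?_
    refine IsClosed.inter (isClosed_eq (by fun_prop) (by fun_prop)) ?_
    have hcont : Continuous fun y : (Fin n → Pt) × ℝ =>
        (y.1, (fun i => y.2 * s i), a, b, c) := by fun_prop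
    exact (isClosed_separated (Fin n)).preimage hcont
  have hp₁ : Separated p (fun i => 1 * s i) a b c := by simpa using hp
  have hKne : K.Nonempty :=
    ⟨(p, 1), ⟨Metric.mem_closedBall_self hδ.le, le_rfl, hC hp₁⟩, rfl, hp₁⟩
  obtain ⟨⟨q, t⟩, ⟨⟨hqball, ht₁, -⟩, hqo, hqsep⟩, hmax⟩ :=
    hK.exists_isMaxOn hKne continuous_snd.continuousOn
  simp only at hqball ht₁ hqo hqsep
  have ht : 0 < t := one_pos.trans_le ht₁
  have hqle : ‖q - p‖ ≤ δ := by rwa [← dist_eq_norm]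
  have hqlt : ‖q - p‖ < δ := hqle.lt_of_ne fun h =>
    hsphere q hqo h (hqsep.mono fun i => le_mul_of_one_le_left (hs i).le ht₁)
  refine ⟨q, t, ht, hqlt, (isPacking_iff_separated ha.ne' hc.ne' _ _).mpr
    ⟨fun i => mul_pos ht (hs i), hqsep⟩, (δ - ‖q - p‖) / 2, by linarith, ?_⟩
  intro q' t' ht' hpack' hdist _
  have hsep' := ((isPacking_iff_separated ha.ne' hc.ne' _ _).mp hpack').2
  have ht'_le : t' ≤ 1 := by
    by_contra! hlt
    set v : Pt := q' o - p o with hv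
    have hnorm : ‖q' - q‖ < (δ - ‖q - p‖) / 2 := (norm_sub_le_pdist q' q).trans_lt hdist
    have hball : (fun i => q' i - v) ∈ Metric.closedBall p δ := by
      rw [Metric.mem_closedBall, dist_eq_norm]
      refine (pi_norm_le_iff_of_nonneg hδ.le).mpr fun i => ?_
      have e : (fun i => q' i - v - p i) i = (q' - q) i - (q' - q) o + (q - p) i := by
        simp only [Pi.sub_apply, hv, hqo]; abel
      calc ‖((fun i => q' i - v) - p) i‖ = ‖(q' - q) i - (q' - q) o + (q - p) i‖ := by
            rw [← e]; rfl
        _ ≤ ‖(q' - q) i‖ + ‖(q' - q) o‖ + ‖(q - p) i‖ :=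
            (norm_add_le _ _).trans (add_le_add_left (norm_sub_le _ _) _)
        _ ≤ δ := by
            linarith [norm_le_pi_norm (q' - q) i, norm_le_pi_norm (q' - q) o,
              norm_le_pi_norm (q - p) i]
    have hsep'' : Separated (fun i => q' i - v) (fun i => (t' * t) * s i) a b c := by
      simpa only [mul_assoc] using hsep'.sub_const v
    have hle : t' * t ≤ t := hmax (a := ((fun i => q' i - v), t' * t))
      ⟨⟨hball, one_le_mul_of_one_le_of_one_le hlt.le ht₁, hC hsep''⟩, by simp [hv], hsep''⟩
    nlinarith
  unfold density
  gcongr with i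
  · exact mul_nonneg ht'.le (mul_pos ht (hs i)).le
  · exact mul_le_of_le_one_left (mul_pos ht (hs i)).le ht'_le

/-- Near a packing whose centers are isolated on the sphere of radius `δ`, slightly shrunken radii
give a packing which is robust under perturbing radii and lattice, and still no packing on the
sphere. -/
lemma exists_shrink_eventually {n : ℕ} {p : Fin n → Pt} {r : Fin n → ℝ} {a b c δ : ℝ}
    (ha : 0 < a) (hc : 0 < c) (o : Fin n) (hr : ∀ i, 0 < r i)
    (hp : Separated p r a b c)
    (hsphere : ∀ q : Fin n → Pt, q o = p o → ‖q - p‖ = δ → ¬Separated q r a b c) :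
    ∃ θ : ℝ, 0 < θ ∧ ∀ᶠ y : (Fin n → ℝ) × ℝ × ℝ × ℝ in nhds (θ • r, a, b, c),
      Separated p y.1 y.2.1 y.2.2.1 y.2.2.2 ∧
      ∀ q : Fin n → Pt, q o = p o → ‖q - p‖ = δ →
        ¬Separated q y.1 y.2.1 y.2.2.1 y.2.2.2 := by
  let S : Set (Fin n → Pt) := Metric.sphere p δ ∩ {q | q o = p o}
  have hS : IsCompact S := (isCompact_sphere p δ).inter_right
    (isClosed_eq (by fun_prop) (by fun_prop))
  let Z : Set ((Fin n → ℝ) × ℝ × ℝ × ℝ) :=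
    {y | ∀ q ∈ S, ¬Separated q y.1 y.2.1 y.2.2.1 y.2.2.2}
  have hZ : IsOpen Z := by
    refine isOpen_iff_mem_nhds.mpr fun y hy => ?_
    refine hS.eventually_forall_of_forall_eventually fun q hq => ?_
    exact ((isClosed_separated (Fin n)).isOpen_compl.preimage continuous_swap).mem_nhds (hy q hq)
  have hmem (q : Fin n → Pt) (h₁ : q o = p o) (h₂ : ‖q - p‖ = δ) : q ∈ S :=
    ⟨by rwa [mem_sphere_iff_norm], h₁⟩
  have hrZ : (r, a, b, c) ∈ Z := fun q hq =>
    hsphere q hq.2 (by rw [← dist_eq_norm]; exact hq.1)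
  have hcont : Continuous fun θ : ℝ => (θ • r, a, b, c) := by fun_prop
  have hev : ∀ᶠ θ : ℝ in nhds 1, (θ • r, a, b, c) ∈ Z :=
    (hZ.preimage hcont).mem_nhds (by simpa using hrZ)
  obtain ⟨θ, ⟨hθZ, hθ₀⟩, hθ₁⟩ := (((hev.and (lt_mem_nhds one_pos)).filter_mono
    nhdsWithin_le_nhds).and (self_mem_nhdsWithin (s := Set.Iio (1 : ℝ)))).exists
  refine ⟨θ, hθ₀, ?_⟩
  have htend : Continuous fun y : (Fin n → ℝ) × ℝ × ℝ × ℝ => (p, y) := by fun_prop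
  filter_upwards [hZ.mem_nhds hθZ, (htend.tendsto (θ • r, a, b, c)).eventually
    (eventually_strict_separated p (θ • r) (b := b) ha hc)] with y hyZ hy
  refine ⟨fun i j z hz => (hy i j z ?_).le, fun q h₁ h₂ => hyZ q (hmem q h₁ h₂)⟩
  refine lt_of_lt_of_le ?_ (hp i j z hz)
  simp only [Pi.smul_apply, smul_eq_mul]
  exact add_lt_add (mul_lt_of_lt_one_left (hr i) hθ₁) (mul_lt_of_lt_one_left (hr j) hθ₁)

/-- The radii with first entry `m` and ratios `x` to the first entry. -/
def radiiOfRatios {n : ℕ} (hn : 0 < n) (m : ℝ) (x : Fin (n - 1) → ℝ) (i : Fin n) : ℝ :=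
  if h : i = ⟨0, hn⟩ then m
  else m * x ⟨(i : ℕ) - 1, by
    have : (i : ℕ) ≠ 0 := fun h' => h (Fin.ext h')
    have := i.isLt
    omega⟩

lemma continuous_radiiOfRatios {n : ℕ} (hn : 0 < n) (m : ℝ) :
    Continuous (radiiOfRatios hn m) := by
  refine continuous_pi fun i => ?_
  unfold radiiOfRatios
  split_ifs
  · exact continuous_const
  · fun_prop

lemma radiiOfRatios_zero {n : ℕ} (hn : 0 < n) (m : ℝ) (x : Fin (n - 1) → ℝ) :
    radiiOfRatios hn m x ⟨0, hn⟩ = m := by simp [radiiOfRatios]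

lemma radiiOfRatios_succ {n : ℕ} (hn : 0 < n) (m : ℝ) (x : Fin (n - 1) → ℝ) (i : Fin (n - 1))
    (hi : (i : ℕ) + 1 < n) : radiiOfRatios hn m x ⟨(i : ℕ) + 1, hi⟩ = m * x i := by
  simp [radiiOfRatios]

lemma radiiOfRatios_ratios {n : ℕ} (hn : 0 < n) (θ : ℝ) {r : Fin n → ℝ} (hr : r ⟨0, hn⟩ ≠ 0) :
    radiiOfRatios hn (θ * r ⟨0, hn⟩)
      (fun i => r ⟨(i : ℕ) + 1, by have := i.isLt; omega⟩ / r ⟨0, hn⟩) = θ • r := by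
  funext i
  by_cases h : i = ⟨0, hn⟩
  · subst h; simp [radiiOfRatios]
  · have hi : (i : ℕ) ≠ 0 := fun h' => h (Fin.ext h')
    have hi' : (⟨(i : ℕ) - 1 + 1, by have := i.isLt; omega⟩ : Fin n) = i :=
      Fin.ext (by simp only; omega)
    simp only [radiiOfRatios, h, dite_false, hi', Pi.smul_apply, smul_eq_mul]
    field_simp

/-- The parameter set of a collectively jammed packing is a neighborhood of its own parameters. -/
lemma paramSet_mem_nhds {n : ℕ} (hn : 0 < n) {a₀ b₀ δ ε : ℝ} (ha₀ : 0 < a₀)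
    {p : Fin n → Pt} {r : Fin n → ℝ} (hr : ∀ i, 0 < r i)
    (hp : Separated p r a₀ b₀ (1 / a₀)) (hδ : 0 < δ) (hδε : n * δ ≤ ε)
    (hsphere : ∀ q : Fin n → Pt, q ⟨0, hn⟩ = p ⟨0, hn⟩ → ‖q - p‖ = δ →
      ¬Separated q r a₀ b₀ (1 / a₀)) :
    paramSet n hn p ε ∈ nhds
      ((fun i : Fin (n - 1) => r ⟨(i : ℕ) + 1, by have := i.isLt; omega⟩ / r ⟨0, hn⟩),
        a₀, b₀) := by
  obtain ⟨θ, hθ, hev⟩ := exists_shrink_eventually ha₀ (one_div_pos.mpr ha₀) _ hr hp hsphere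
  set m : ℝ := θ * r ⟨0, hn⟩ with hm
  have hmpos : 0 < m := mul_pos hθ (hr _)
  set x₀ : (Fin (n - 1) → ℝ) × ℝ × ℝ :=
    ((fun i : Fin (n - 1) => r ⟨(i : ℕ) + 1, by have := i.isLt; omega⟩ / r ⟨0, hn⟩), a₀, b₀)
    with hx₀
  have htend : Filter.Tendsto (fun x : (Fin (n - 1) → ℝ) × ℝ × ℝ =>
      (radiiOfRatios hn m x.1, x.2.1, x.2.2, 1 / x.2.1)) (nhds x₀)
      (nhds (θ • r, a₀, b₀, 1 / a₀)) := by
    rw [← radiiOfRatios_ratios hn θ (hr _).ne']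
    refine ContinuousAt.tendsto (x := x₀) (f := fun x : (Fin (n - 1) → ℝ) × ℝ × ℝ =>
      (radiiOfRatios hn m x.1, x.2.1, x.2.2, 1 / x.2.1)) ?_
    refine ((continuous_radiiOfRatios hn m).comp continuous_fst).continuousAt.prodMk ?_
    refine ContinuousAt.prodMk (by fun_prop) (ContinuousAt.prodMk (by fun_prop) ?_)
    exact continuousAt_const.div (by fun_prop) ha₀.ne'
  have hpos : ∀ᶠ y : (Fin n → ℝ) × ℝ × ℝ × ℝ in nhds (θ • r, a₀, b₀, 1 / a₀),
      (∀ i, 0 < y.1 i) ∧ 0 < y.2.1 := by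
    refine (Filter.eventually_all.mpr fun i => ?_).and ?_
    · exact (isOpen_lt (by fun_prop) (by fun_prop)).mem_nhds (mul_pos hθ (hr i))
    · exact (isOpen_lt (by fun_prop) (by fun_prop)).mem_nhds ha₀
  filter_upwards [htend.eventually hev, htend.eventually hpos] with x ⟨hxp, hxs⟩ ⟨hxr, hxa⟩
  obtain ⟨q, t, ht, hq, hdense⟩ :=
    exists_locallyMaxDense hxa (one_div_pos.mpr hxa) hδ ⟨0, hn⟩ hxr hxp hxs
  refine ⟨hxa, q, _, hdense, fun i => ?_, ?_⟩
  · simp only [radiiOfRatios_zero, radiiOfRatios_succ]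
    field_simp
  · refine (pdist_le_card_mul_norm_sub q p).trans_lt (lt_of_lt_of_le ?_ hδε)
    rw [Fintype.card_fin]
    exact mul_lt_mul_of_pos_left hq (by exact_mod_cast hn)

/-- **Theorem 5.4.**  Let `(p, r)` be a collectively jammed packing of `n` disks in
`ℝ²/Λ(a₀, b₀)`.  For every sufficiently small `ε > 0`, the set of parameters
`(r̄, a, b)` realized by locally maximally dense packings with centers within `ε` of `p`
contains an open neighborhood of `(r̄₀, a₀, b₀)`; in particular its Hausdorff dimension
is `n + 1`. -/
theorem dimension_of_parameter_space
    (n : ℕ) (hn : 0 < n) (a₀ b₀ : ℝ) (ha₀ : 0 < a₀)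
    (p : Fin n → Pt) (r : Fin n → ℝ)
    (hpack : IsPacking (latAB a₀ b₀) p r)
    (hjam : CollectivelyJammed (latAB a₀ b₀) p r) :
    ∃ ε₀ > 0, ∀ ε : ℝ, 0 < ε → ε ≤ ε₀ →
      (∃ U : Set ((Fin (n - 1) → ℝ) × ℝ × ℝ), IsOpen U ∧
        ((fun i : Fin (n - 1) => r ⟨(i : ℕ) + 1, by have := i.isLt; omega⟩ / r ⟨0, hn⟩),
          a₀, b₀) ∈ U ∧
        U ⊆ paramSet n hn p ε) ∧
      dimH (paramSet n hn p ε) = n + 1 := by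
  have hc₀ : 0 < 1 / a₀ := one_div_pos.mpr ha₀
  obtain ⟨hr, hp⟩ := (isPacking_iff_separated ha₀.ne' hc₀.ne' p r).mp hpack
  obtain ⟨δ₀, hδ₀, hiso⟩ := hjam.exists_isolated ha₀ hc₀ hpack ⟨0, hn⟩
  have hn' : (0 : ℝ) < n := by exact_mod_cast hn
  refine ⟨n * δ₀, mul_pos hn' hδ₀, fun ε hε hεle => ?_⟩
  have hδ : 0 < ε / n := div_pos hε hn'
  have hmem := paramSet_mem_nhds hn ha₀ hr hp hδ (mul_div_cancel₀ ε hn'.ne').le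
    fun q hq hqδ hsep => by
      have hle : ε / n ≤ δ₀ := by rwa [div_le_iff₀ hn', mul_comm]
      rw [hiso q hq (hqδ.le.trans hle) hsep, sub_self, norm_zero] at hqδ
      exact hδ.ne hqδ
  refine ⟨?_, ?_⟩
  · obtain ⟨U, hU, hUo, hxU⟩ := mem_nhds_iff.mp hmem
    exact ⟨U, hUo, hxU, hU⟩
  · rw [Real.dimH_of_mem_nhds hmem]
    have : Module.finrank ℝ ((Fin (n - 1) → ℝ) × ℝ × ℝ) = n + 1 := by
      simp only [Module.finrank_prod, Module.finrank_fin_fun, Module.finrank_self]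
      omega
    rw [this]
    push_cast
    rfl

end IsostaticPaper
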